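/- arXiv:2211.05566 — 2 statements merged into one kernel-verified Lean document; each statement's English description precedes it below -/
import Mathlib

section
/- Let Q_1, …, Q_m be nonempty subsets of {1,…,n} with selection matrices H_i ∈ ℝ^{n_i×n}, n_i := |Q_i|, and suppose that for every j ∈ {1,…,n} the number of indices i with j ∈ Q_i is at least 2p + 1. Let x ∈ ℝ^n, γ ≥ 0, and η_i ∈ ℝ^{n_i} for each i, and suppose ‖η_i − H_i x‖₂ ≤ γ holds for at least m − p indices i. Then every global minimizer x̂ ∈ ℝ^n of z ↦ Σ_{i=1}^m ‖η_i − H_i z‖₁ satisfies ‖x̂ − x‖_∞ ≤ γ. -/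
open Matrix

/-- The 1-norm of a real vector. -/
def norm1 {n : ℕ} (x : Fin n → ℝ) : ℝ := ∑ j, |x j|

/-- The Euclidean (2-)norm of a real vector. -/
noncomputable def vnorm2 {n : ℕ} (x : Fin n → ℝ) : ℝ := Real.sqrt (∑ j, (x j) ^ 2)

/-- The selection matrix of `Q ⊆ {1,…,n}`: its rows are the transposed canonical basis
vectors `e_jᵀ`, `j ∈ Q`, listed in increasing order of `j`. -/
def selMatrix {n d : ℕ} (Q : Finset (Fin n)) (h : Q.card = d) :
    Matrix (Fin d) (Fin n) ℝ :=
  Matrix.of fun k j => if j = (Q.orderIsoOfFin h k : Fin n) then 1 else 0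

lemma selMatrix_mulVec {n d : ℕ} (Q : Finset (Fin n)) (h : Q.card = d) (z : Fin n → ℝ)
    (k : Fin d) : (selMatrix Q h).mulVec z k = z (Q.orderIsoOfFin h k) := by
  change ∑ j, (if j = (Q.orderIsoOfFin h k : Fin n) then (1 : ℝ) else 0) * z j = _
  rw [Finset.sum_eq_single (Q.orderIsoOfFin h k : Fin n)]
  · rw [if_pos rfl, one_mul]
  · intro j _ hj
    rw [if_neg hj, zero_mul]
  · simp

lemma abs_apply_le_vnorm2 {n : ℕ} (x : Fin n → ℝ) (k : Fin n) : |x k| ≤ vnorm2 x :=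
  Real.abs_le_sqrt (Finset.single_le_sum (f := fun j => x j ^ 2)
    (fun _ _ => sq_nonneg _) (Finset.mem_univ k))

lemma norm1_sub_norm1_update_of_notMem {n d : ℕ} (Q : Finset (Fin n)) (h : Q.card = d)
    (y : Fin d → ℝ) (z : Fin n → ℝ) {j : Fin n} (hj : j ∉ Q) (w : ℝ) :
    norm1 (y - (selMatrix Q h).mulVec z)
      - norm1 (y - (selMatrix Q h).mulVec (Function.update z j w)) = 0 := by
  rw [sub_eq_zero]
  refine Finset.sum_congr rfl fun k _ => ?_
  have hk : (Q.orderIsoOfFin h k : Fin n) ≠ j := fun e =>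
    hj (e ▸ (Q.orderIsoOfFin h k).2)
  rw [Pi.sub_apply, Pi.sub_apply, selMatrix_mulVec, selMatrix_mulVec,
    Function.update_of_ne hk]

lemma norm1_sub_norm1_update {n d : ℕ} (Q : Finset (Fin n)) (h : Q.card = d)
    (y : Fin d → ℝ) (z : Fin n → ℝ) (k : Fin d) (w : ℝ) :
    norm1 (y - (selMatrix Q h).mulVec z)
      - norm1 (y - (selMatrix Q h).mulVec
          (Function.update z (Q.orderIsoOfFin h k : Fin n) w))
      = |y k - z (Q.orderIsoOfFin h k)| - |y k - w| := by
  unfold norm1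
  rw [← Finset.sum_sub_distrib, Finset.sum_eq_single k]
  · rw [Pi.sub_apply, Pi.sub_apply, selMatrix_mulVec, selMatrix_mulVec,
      Function.update_self]
  · intro l _ hl
    have hne : (Q.orderIsoOfFin h l : Fin n) ≠ Q.orderIsoOfFin h k := fun e =>
      hl ((Q.orderIsoOfFin h).injective (Subtype.ext e))
    rw [Pi.sub_apply, Pi.sub_apply, selMatrix_mulVec, selMatrix_mulVec,
      Function.update_of_ne hne, sub_self]
  · simp

/-- A point outside a ball of radius `γ` has a nearest point `w` of the ball which separates
it from every point of the ball. -/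
lemma exists_abs_sub_eq_add {a b γ : ℝ} (h : γ < |b - a|) :
    ∃ w, w ≠ b ∧ ∀ t, |t - a| ≤ γ → |t - b| = |t - w| + |w - b| := by
  rcases lt_abs.1 h with h | h
  · refine ⟨a + γ, by linarith, fun t ht => ?_⟩
    have ht := abs_le.1 ht
    rw [abs_of_nonpos (by linarith : t - b ≤ 0),
      abs_of_nonpos (by linarith : t - (a + γ) ≤ 0),
      abs_of_nonpos (by linarith : a + γ - b ≤ 0)]
    ring
  · refine ⟨a - γ, by linarith, fun t ht => ?_⟩
    have ht := abs_le.1 ht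
    rw [abs_of_nonneg (by linarith : 0 ≤ t - b),
      abs_of_nonneg (by linarith : 0 ≤ t - (a - γ)),
      abs_of_nonneg (by linarith : 0 ≤ a - γ - b)]
    ring

/-- Theorem 4, resilient fusion: if every state index `j` is covered by at
least `2p + 1` of the sets `Q_i`, and `‖η_i − H_i x‖₂ ≤ γ` holds for at least `m − p`
indices `i`, then every global minimizer `x̂` of `z ↦ ∑_i ‖η_i − H_i z‖₁` satisfies
`‖x̂ − x‖_∞ ≤ γ`. -/
theorem stmt12 {n m p : ℕ} (Q : Fin m → Finset (Fin n)) (hQ : ∀ i, (Q i).Nonempty)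
    (hcover : ∀ j : Fin n, 2 * p + 1 ≤ (Finset.univ.filter fun i => j ∈ Q i).card)
    (x : Fin n → ℝ) (γ : ℝ) (hγ : 0 ≤ γ)
    (η : ∀ i, Fin (Q i).card → ℝ)
    (hbenign : m - p ≤ (Finset.univ.filter fun i =>
        vnorm2 (η i - (selMatrix (Q i) rfl).mulVec x) ≤ γ).card)
    (xhat : Fin n → ℝ)
    (hmin : ∀ z : Fin n → ℝ,
      ∑ i, norm1 (η i - (selMatrix (Q i) rfl).mulVec xhat)
        ≤ ∑ i, norm1 (η i - (selMatrix (Q i) rfl).mulVec z)) :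
    ∀ j, |xhat j - x j| ≤ γ := by
  classical
  intro j
  by_contra! hj
  obtain ⟨w, hw, hsep⟩ := exists_abs_sub_eq_add hj
  have hδ : 0 < |w - xhat j| := abs_pos.2 (sub_ne_zero.2 hw)
  set C := Finset.univ.filter fun i => j ∈ Q i
  set G := Finset.univ.filter fun i => vnorm2 (η i - (selMatrix (Q i) rfl).mulVec x) ≤ γ
  have hbound : ∀ i, ((if i ∈ C ∩ G then |w - xhat j| else 0)
        - if i ∈ C \ G then |w - xhat j| else 0)
      ≤ norm1 (η i - (selMatrix (Q i) rfl).mulVec xhat)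
        - norm1 (η i - (selMatrix (Q i) rfl).mulVec (Function.update xhat j w)) := by
    intro i
    by_cases hi : j ∈ Q i
    · have hiC : i ∈ C := by simp [C, hi]
      obtain ⟨k, hk⟩ := ((Q i).orderIsoOfFin rfl).surjective ⟨j, hi⟩
      have hkj : ((Q i).orderIsoOfFin rfl k : Fin n) = j := congrArg Subtype.val hk
      have key := norm1_sub_norm1_update (Q i) rfl (η i) xhat k w
      rw [hkj] at key
      rw [key]
      by_cases hiG : i ∈ G
      · have hle := (abs_apply_le_vnorm2 _ k).trans (Finset.mem_filter.1 hiG).2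
        rw [Pi.sub_apply, selMatrix_mulVec, hkj] at hle
        simp [hiC, hiG, hsep _ hle]
      · have htri := abs_sub_le (η i k) (xhat j) w
        rw [abs_sub_comm (xhat j) w] at htri
        simp only [Finset.mem_inter, Finset.mem_sdiff, hiC, hiG, and_false, not_false_eq_true,
          and_self, if_true, if_false]
        linarith
    · have hiC : i ∉ C := by simp [C, hi]
      rw [norm1_sub_norm1_update_of_notMem _ _ _ _ hi]
      simp [hiC]
  have hsum := Finset.sum_le_sum fun i (_ : i ∈ Finset.univ) => hbound i
  rw [Finset.sum_sub_distrib, Finset.sum_sub_distrib, Finset.sum_ite_mem,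
    Finset.sum_ite_mem, Finset.univ_inter, Finset.univ_inter, Finset.sum_const,
    Finset.sum_const, nsmul_eq_mul, nsmul_eq_mul] at hsum
  have hcard := Finset.card_inter_add_card_sdiff C G
  have hbad : (C \ G).card ≤ Gᶜ.card := Finset.card_le_card fun i hi => by
    simpa using (Finset.mem_sdiff.1 hi).2
  rw [Finset.card_compl, Fintype.card_fin] at hbad
  have hlt : (C \ G).card < (C ∩ G).card := by
    have := hcover j
    change 2 * p + 1 ≤ C.card at this
    omega
  have hlt' : ((C \ G).card : ℝ) < (C ∩ G).card := by exact_mod_cast hlt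
  have := mul_lt_mul_of_pos_right hlt' hδ
  linarith [hmin (Function.update xhat j w)]
end

section
/- Let Q ⊆ {1,…,n} with d := |Q| ≥ 1 and H ∈ ℝ^{d×n} the selection matrix for Q. Let A ∈ ℝ^{n×n}, C ∈ ℝ^{1×n}, Ã ∈ ℝ^{d×d}, C̃ ∈ ℝ^{1×d}, and L ∈ ℝ^{d×1} satisfy Ã H = H A and C̃ H = C. Let γ > 0 and B_w, B_v ≥ 0 satisfy γ ≥ B_w + ‖L‖₂ B_v and σ_max(Ã − L C̃) ≤ (γ − B_w − ‖L‖₂ B_v) / ((2√d + 1) γ). Suppose x, x̂ ∈ ℝ^n with ‖x̂ − x‖_∞ ≤ γ, w ∈ ℝ^n with ‖w‖₂ ≤ B_w, v ∈ ℝ with |v| ≤ B_v, and η⁺ ∈ ℝ^d satisfies either η⁺ = H x̂, or ‖η⁺ − H x̂‖₂ ≤ (√d + 1) γ. Then, with x' := A x + w and η' := (Ã − L C̃) η⁺ + L (C x + v), one has ‖η' − H x'‖₂ ≤ γ. -/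
open Matrix

/-- The induced 2-norm (largest singular value) of a real matrix. -/
noncomputable def mat2Norm {p q : ℕ} (M : Matrix (Fin p) (Fin q) ℝ) : ℝ :=
  ‖LinearMap.toContinuousLinearMap (Matrix.toEuclideanLin M)‖

theorem vnorm2_eq_norm_toLp {n : ℕ} (x : Fin n → ℝ) : vnorm2 x = ‖WithLp.toLp 2 x‖ := by
  simp [vnorm2, EuclideanSpace.norm_eq]

theorem vnorm2_add_le {n : ℕ} (x y : Fin n → ℝ) : vnorm2 (x + y) ≤ vnorm2 x + vnorm2 y := by
  simpa only [vnorm2_eq_norm_toLp, WithLp.toLp_add] using norm_add_le _ _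

theorem vnorm2_sub_le {n : ℕ} (x y : Fin n → ℝ) : vnorm2 (x - y) ≤ vnorm2 x + vnorm2 y := by
  simpa only [vnorm2_eq_norm_toLp, WithLp.toLp_sub] using norm_sub_le _ _

theorem vnorm2_smul {n : ℕ} (a : ℝ) (x : Fin n → ℝ) : vnorm2 (a • x) = |a| * vnorm2 x := by
  simp only [vnorm2_eq_norm_toLp, WithLp.toLp_smul, norm_smul, Real.norm_eq_abs]

theorem vnorm2_mulVec_le {p q : ℕ} (M : Matrix (Fin p) (Fin q) ℝ) (x : Fin q → ℝ) :
    vnorm2 (M.mulVec x) ≤ mat2Norm M * vnorm2 x := by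
  simp only [vnorm2_eq_norm_toLp]
  exact (LinearMap.toContinuousLinearMap (Matrix.toEuclideanLin M)).le_opNorm (WithLp.toLp 2 x)

theorem vnorm2_le_sqrt_mul {n : ℕ} {x : Fin n → ℝ} {γ : ℝ} (hγ : 0 ≤ γ)
    (hx : ∀ j, |x j| ≤ γ) : vnorm2 x ≤ Real.sqrt n * γ := by
  rw [← Real.sqrt_sq hγ, ← Real.sqrt_mul (Nat.cast_nonneg n)]
  refine Real.sqrt_le_sqrt ?_
  calc ∑ j, x j ^ 2 ≤ ∑ _j : Fin n, γ ^ 2 :=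
        Finset.sum_le_sum fun j _ => sq_le_sq' (abs_le.mp (hx j)).1 (abs_le.mp (hx j)).2
    _ = n * γ ^ 2 := by simp

theorem selMatrix_mulVec_apply {n d : ℕ} (Q : Finset (Fin n)) (h : Q.card = d)
    (x : Fin n → ℝ) (k : Fin d) :
    (selMatrix Q h).mulVec x k = x (Q.orderIsoOfFin h k) := by
  simp only [selMatrix, Matrix.mulVec, dotProduct, Matrix.of_apply, boole_mul,
    Finset.sum_ite_eq', Finset.mem_univ, if_true]

theorem vnorm2_selMatrix_mulVec_le {n d : ℕ} (Q : Finset (Fin n)) (h : Q.card = d)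
    (x : Fin n → ℝ) : vnorm2 ((selMatrix Q h).mulVec x) ≤ vnorm2 x := by
  refine Real.sqrt_le_sqrt ?_
  simp only [selMatrix_mulVec_apply]
  calc ∑ k, x (Q.orderIsoOfFin h k) ^ 2 = ∑ i : Q, x i ^ 2 :=
        (Q.orderIsoOfFin h).toEquiv.sum_comp fun i : Q => x i ^ 2
    _ = ∑ i ∈ Q, x i ^ 2 := Finset.sum_coe_sort Q fun i => x i ^ 2
    _ ≤ ∑ i, x i ^ 2 :=
        Finset.sum_le_sum_of_subset_of_nonneg (Finset.subset_univ Q) fun i _ _ => sq_nonneg (x i)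

/-- Lemma 5: with `H` the selection matrix for `Q` (`|Q| = d ≥ 1`),
`Ã H = H A`, `C̃ H = C`, the design inequality
`σ_max(Ã − L C̃) ≤ (γ − B_w − ‖L‖₂ B_v)/((2√d + 1)γ)` with `γ ≥ B_w + ‖L‖₂ B_v`, and
`‖x̂ − x‖_∞ ≤ γ`, `‖w‖₂ ≤ B_w`, `|v| ≤ B_v`, and `η⁺` either reset to `H x̂` or satisfying
`‖η⁺ − H x̂‖₂ ≤ (√d + 1)γ`, one has `‖η' − H x'‖₂ ≤ γ`, where `x' = A x + w` and
`η' = (Ã − L C̃) η⁺ + L (C x + v)`. -/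
theorem stmt14 {n d : ℕ} (Q : Finset (Fin n)) (hQd : Q.card = d) (hd : 1 ≤ d)
    (H : Matrix (Fin d) (Fin n) ℝ) (hH : H = selMatrix Q hQd)
    (A : Matrix (Fin n) (Fin n) ℝ) (c : Fin n → ℝ)
    (Atil : Matrix (Fin d) (Fin d) ℝ) (ctil : Fin d → ℝ) (L : Fin d → ℝ)
    (hAH : Atil * H = H * A) (hCH : Matrix.vecMul ctil H = c)
    (γ Bw Bv : ℝ) (hγ : 0 < γ) (hBw : 0 ≤ Bw) (hBv : 0 ≤ Bv)
    (hγ2 : Bw + vnorm2 L * Bv ≤ γ)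
    (hσ : mat2Norm (Atil - Matrix.vecMulVec L ctil)
        ≤ (γ - Bw - vnorm2 L * Bv) / ((2 * Real.sqrt d + 1) * γ))
    (x xhat : Fin n → ℝ) (hx : ∀ j, |xhat j - x j| ≤ γ)
    (w : Fin n → ℝ) (hw : vnorm2 w ≤ Bw)
    (v : ℝ) (hv : |v| ≤ Bv)
    (ηp : Fin d → ℝ)
    (hηp : ηp = H.mulVec xhat ∨ vnorm2 (ηp - H.mulVec xhat) ≤ (Real.sqrt d + 1) * γ) :
    vnorm2 ((Atil - Matrix.vecMulVec L ctil).mulVec ηp + (c ⬝ᵥ x + v) • L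
      - H.mulVec (A.mulVec x + w)) ≤ γ := by
  have h_error : (Atil - Matrix.vecMulVec L ctil).mulVec ηp + (c ⬝ᵥ x + v) • L
      - H.mulVec (A.mulVec x + w)
      = (Atil - Matrix.vecMulVec L ctil).mulVec (ηp - H.mulVec x) + v • L - H.mulVec w := by
    have h_state : Atil.mulVec (H.mulVec x) = H.mulVec (A.mulVec x) := by
      rw [Matrix.mulVec_mulVec, hAH, Matrix.mulVec_mulVec]
    have h_output : (Matrix.vecMulVec L ctil).mulVec (H.mulVec x) = (c ⬝ᵥ x) • L := by
      rw [Matrix.vecMulVec_mulVec, Matrix.dotProduct_mulVec, hCH]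
      simp
    rw [Matrix.mulVec_sub, Matrix.sub_mulVec _ _ (H.mulVec x), h_state, h_output,
      Matrix.mulVec_add, add_smul]
    abel
  have h_sel : vnorm2 (H.mulVec xhat - H.mulVec x) ≤ Real.sqrt d * γ := by
    refine vnorm2_le_sqrt_mul hγ.le fun k => ?_
    simpa only [hH, Pi.sub_apply, selMatrix_mulVec_apply] using hx _
  have h_reset : vnorm2 (ηp - H.mulVec xhat) ≤ (Real.sqrt d + 1) * γ := by
    rcases hηp with rfl | h
    · rw [sub_self, vnorm2_eq_norm_toLp, WithLp.toLp_zero, norm_zero]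
      positivity
    · exact h
  have h_prior : vnorm2 (ηp - H.mulVec x) ≤ (2 * Real.sqrt d + 1) * γ := by
    have h_triangle := vnorm2_add_le (ηp - H.mulVec xhat) (H.mulVec xhat - H.mulVec x)
    rw [sub_add_sub_cancel] at h_triangle
    linarith
  have h_contract : vnorm2 ((Atil - Matrix.vecMulVec L ctil).mulVec (ηp - H.mulVec x))
      ≤ γ - Bw - vnorm2 L * Bv := by
    have h_nonneg : 0 ≤ mat2Norm (Atil - Matrix.vecMulVec L ctil) := norm_nonneg _
    calc _ ≤ mat2Norm (Atil - Matrix.vecMulVec L ctil) * vnorm2 (ηp - H.mulVec x) :=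
          vnorm2_mulVec_le _ _
      _ ≤ mat2Norm (Atil - Matrix.vecMulVec L ctil) * ((2 * Real.sqrt d + 1) * γ) := by gcongr
      _ ≤ γ - Bw - vnorm2 L * Bv := (le_div_iff₀ (by positivity)).mp hσ
  have h_meas : vnorm2 (v • L) ≤ vnorm2 L * Bv := by
    rw [vnorm2_smul, mul_comm]
    exact mul_le_mul_of_nonneg_left hv (Real.sqrt_nonneg _)
  have h_process : vnorm2 (H.mulVec w) ≤ Bw := by
    rw [hH]
    exact (vnorm2_selMatrix_mulVec_le Q hQd w).trans hw
  rw [h_error]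
  linarith [vnorm2_sub_le ((Atil - Matrix.vecMulVec L ctil).mulVec (ηp - H.mulVec x) + v • L)
      (H.mulVec w),
    vnorm2_add_le ((Atil - Matrix.vecMulVec L ctil).mulVec (ηp - H.mulVec x)) (v • L)]
end
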